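/- For every s ∈ ℝ and every a = (a_1, …, a_r) ∈ (ℝ^l)^r, the jet-lifting map satisfies the weighted-homogeneity (reparametrisation) equivariance J_{x₀,y₀,r}(s a_1, s² a_2, …, s^r a_r) = (s b_1, s² b_2, …, s^r b_r), where (b_1, …, b_r) = J_{x₀,y₀,r}(a_1, …, a_r). -/

import Mathlib

/-- The polynomial curve `t ↦ c₀ + ∑_{j=1}^r c_j t^j` in `ℝ^d`
(indexing: `c j` is the coefficient of `t^(j+1)` for `j : Fin r`). -/
noncomputable def polyCurve {d : ℕ} (c₀ : Fin d → ℝ) {r : ℕ} (c : Fin r → (Fin d → ℝ)) :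
    ℝ → (Fin d → ℝ) :=
  fun t => c₀ + ∑ j : Fin r, t ^ ((j : ℕ) + 1) • c j

/-- `IsJetLift f x₀ y₀ r a b` : setting `x t = x₀ + ∑ a_j t^j` and `y t = y₀ + ∑ b_j t^j`,
the defect `g t = y′ t − f (x t, y t) (x′ t)` vanishes to order `r` at `t = 0`. -/
def IsJetLift {l p : ℕ}
    (f : (Fin l → ℝ) × (Fin p → ℝ) → ((Fin l → ℝ) →L[ℝ] (Fin p → ℝ)))
    (x₀ : Fin l → ℝ) (y₀ : Fin p → ℝ) (r : ℕ)
    (a : Fin r → (Fin l → ℝ)) (b : Fin r → (Fin p → ℝ)) : Prop :=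
  ∀ j < r,
    iteratedDeriv j
      (fun t : ℝ =>
        deriv (polyCurve y₀ b) t
          - f (polyCurve x₀ a t, polyCurve y₀ b t) (deriv (polyCurve x₀ a) t)) 0 = 0

/-- Rescaling the coefficients of a polynomial curve with weights is rescaling time. -/
theorem polyCurve_weighted_smul {d r : ℕ} (c₀ : Fin d → ℝ) (c : Fin r → (Fin d → ℝ)) (s : ℝ) :
    polyCurve c₀ (fun j : Fin r => s ^ ((j : ℕ) + 1) • c j) =
      fun t => polyCurve c₀ c (s * t) := by
  funext t
  simp only [polyCurve, smul_smul, mul_pow, mul_comm]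

theorem contDiff_polyCurve {d r : ℕ} (c₀ : Fin d → ℝ) (c : Fin r → (Fin d → ℝ)) :
    ContDiff ℝ (⊤ : ℕ∞) (polyCurve c₀ c) := by
  unfold polyCurve
  fun_prop

theorem contDiff_deriv_polyCurve {d r : ℕ} (c₀ : Fin d → ℝ) (c : Fin r → (Fin d → ℝ)) :
    ContDiff ℝ (⊤ : ℕ∞) (deriv (polyCurve c₀ c)) :=
  (contDiff_infty_iff_deriv.1 (contDiff_polyCurve c₀ c)).2

/-- The defect of the jet-lifting equation is smooth. -/
theorem contDiff_jetLift_defect {l p : ℕ}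
    {f : (Fin l → ℝ) × (Fin p → ℝ) → ((Fin l → ℝ) →L[ℝ] (Fin p → ℝ))}
    (hf : ContDiff ℝ (⊤ : ℕ∞) f) (x₀ : Fin l → ℝ) (y₀ : Fin p → ℝ) {r : ℕ}
    (a : Fin r → (Fin l → ℝ)) (b : Fin r → (Fin p → ℝ)) :
    ContDiff ℝ (⊤ : ℕ∞) (fun t : ℝ => deriv (polyCurve y₀ b) t
      - f (polyCurve x₀ a t, polyCurve y₀ b t) (deriv (polyCurve x₀ a) t)) :=
  (contDiff_deriv_polyCurve y₀ b).sub
    ((hf.comp ((contDiff_polyCurve x₀ a).prodMk (contDiff_polyCurve y₀ b))).clm_apply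
      (contDiff_deriv_polyCurve x₀ a))

/-- Jet lifts are preserved by the weighted reparametrisation action. -/
theorem IsJetLift.weighted_smul {l p : ℕ}
    {f : (Fin l → ℝ) × (Fin p → ℝ) → ((Fin l → ℝ) →L[ℝ] (Fin p → ℝ))}
    (hf : ContDiff ℝ (⊤ : ℕ∞) f) {x₀ : Fin l → ℝ} {y₀ : Fin p → ℝ} {r : ℕ}
    {a : Fin r → (Fin l → ℝ)} {b : Fin r → (Fin p → ℝ)}
    (h : IsJetLift f x₀ y₀ r a b) (s : ℝ) :
    IsJetLift f x₀ y₀ r (fun j : Fin r => s ^ ((j : ℕ) + 1) • a j)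
      (fun j : Fin r => s ^ ((j : ℕ) + 1) • b j) := by
  intro j hj
  have hg := contDiff_jetLift_defect hf x₀ y₀ a b
  have h0 := h j hj
  set g : ℝ → (Fin p → ℝ) := fun t => deriv (polyCurve y₀ b) t
    - f (polyCurve x₀ a t, polyCurve y₀ b t) (deriv (polyCurve x₀ a) t) with hg_def
  have hgj : ContDiff ℝ j g := hg.of_le (mod_cast le_top)
  have hscale : (fun t : ℝ =>
      deriv (polyCurve y₀ (fun j : Fin r => s ^ ((j : ℕ) + 1) • b j)) t
        - f (polyCurve x₀ (fun j : Fin r => s ^ ((j : ℕ) + 1) • a j) t,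
            polyCurve y₀ (fun j : Fin r => s ^ ((j : ℕ) + 1) • b j) t)
          (deriv (polyCurve x₀ (fun j : Fin r => s ^ ((j : ℕ) + 1) • a j)) t)) =
      s • fun t => g (s * t) := by
    funext t
    simp only [polyCurve_weighted_smul, deriv_comp_mul_left, map_smul, Pi.smul_apply, hg_def,
      smul_sub]
  rw [hscale, iteratedDeriv_const_smul_field, iteratedDeriv_comp_const_smul hgj]
  simp [h0]

/-- Let `J` be the jet-lifting map (sending `a` to the unique `b` with `IsJetLift f x₀ y₀ r a b`).
Then for every `s ∈ ℝ` and every `a`, `J` is equivariant for the weighted reparametrisation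
action: `J (s a₁, s² a₂, …, sʳ aᵣ) = (s b₁, s² b₂, …, sʳ bᵣ)` where `b = J a`. -/
theorem jet_lift_reparametrisation_equivariant
    (l p : ℕ) (hl : 1 ≤ l) (hp : 1 ≤ p)
    (f : (Fin l → ℝ) × (Fin p → ℝ) → ((Fin l → ℝ) →L[ℝ] (Fin p → ℝ)))
    (hf : ContDiff ℝ (⊤ : ℕ∞) f)
    (x₀ : Fin l → ℝ) (y₀ : Fin p → ℝ) (r : ℕ) (hr : 1 ≤ r)
    (J : (Fin r → (Fin l → ℝ)) → (Fin r → (Fin p → ℝ)))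
    (hJ : ∀ a, IsJetLift f x₀ y₀ r a (J a) ∧
      ∀ b, IsJetLift f x₀ y₀ r a b → b = J a)
    (s : ℝ) (a : Fin r → (Fin l → ℝ)) :
    J (fun j : Fin r => s ^ ((j : ℕ) + 1) • a j) = fun j : Fin r => s ^ ((j : ℕ) + 1) • J a j := by
  exact ((hJ _).2 _ ((hJ a).1.weighted_smul hf s)).symm
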